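/- arXiv:2012.03314 — 2 statements merged into one kernel-verified Lean document; each statement's English description precedes it below -/
import Mathlib

section
/- Let r > 0, n ∈ ℕ, a = (a₁,a₂) ∈ F and i ∈ Σ with Π(i) = a. Then μ(B_n(a,r)) ≥ L⁻¹ · m([i|n]) · π(μ)(Q₁(π(Π(σⁿi)), M⁻¹·r / max_{b∈[0,1]²} α₁(D_b S_{i|n}))), where L is the quasi-Bernoulli constant of m and M is the constant from the singular value comparability lemma (M⁻¹ ≤ α₁(D_a S_{i|n})/|f_{i|n,x}(a)| ≤ M for all a, i, n). -/
open MeasureTheory Filter Set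

noncomputable section

namespace FFL

/-- The unit square `[0,1]² ⊆ ℝ²`. -/
def sq : Set (ℝ × ℝ) := Set.Icc (0:ℝ) 1 ×ˢ Set.Icc (0:ℝ) 1

/-- The Euclidean metric on `ℝ²`. -/
def dE (a b : ℝ × ℝ) : ℝ := Real.sqrt ((a.1 - b.1) ^ 2 + (a.2 - b.2) ^ 2)

/-- Squared Frobenius norm of a 2×2 real matrix. -/
def frobSq (A : Matrix (Fin 2) (Fin 2) ℝ) : ℝ := ∑ i, ∑ j, (A i j) ^ 2

/-- The larger singular value `α₁` of a 2×2 real matrix, i.e. the larger positive square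
root of the eigenvalues of `AᵀA`, via the standard closed formula. -/
def sv1 (A : Matrix (Fin 2) (Fin 2) ℝ) : ℝ :=
  Real.sqrt ((frobSq A + Real.sqrt ((frobSq A) ^ 2 - 4 * (A.det) ^ 2)) / 2)

/-- The smaller singular value `α₂` of a 2×2 real matrix. -/
def sv2 (A : Matrix (Fin 2) (Fin 2) ℝ) : ℝ :=
  Real.sqrt ((frobSq A - Real.sqrt ((frobSq A) ^ 2 - 4 * (A.det) ^ 2)) / 2)

/-- The nonlinear, non-conformal iterated function systems of Falconer, Fraser and Lee:
maps `S i (a₁,a₂) = (f i a₁, g i (a₁,a₂))` on the unit square, where `f i`, `g i` are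
`C^{1+α}` contractions (with partial derivatives `fx`, `gx`, `gy`) satisfying the
domination condition. -/
structure System (I : Type) [Fintype I] where
  f : I → ℝ → ℝ
  g : I → ℝ × ℝ → ℝ
  fx : I → ℝ → ℝ
  gx : I → ℝ × ℝ → ℝ
  gy : I → ℝ × ℝ → ℝ
  /-- the index set has at least two elements -/
  card2 : 2 ≤ Fintype.card I
  /-- each `S i` maps the unit square into itself -/
  mapsTo : ∀ i, Set.MapsTo (fun a => (f i a.1, g i a)) sq sq
  /-- `fx i` is the derivative of `f i` on `[0,1]` -/
  hasDeriv_f : ∀ i, ∀ x ∈ Set.Icc (0:ℝ) 1,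
    HasDerivWithinAt (f i) (fx i x) (Set.Icc (0:ℝ) 1) x
  /-- `(gx i, gy i)` is the (total) derivative of `g i` on the unit square -/
  hasDeriv_g : ∀ i, ∀ a ∈ sq, HasFDerivWithinAt (g i)
      (gx i a • ContinuousLinearMap.fst ℝ ℝ ℝ + gy i a • ContinuousLinearMap.snd ℝ ℝ ℝ) sq a
  /-- the derivatives are `α`-Hölder for some `α > 0`, i.e. `f i`, `g i` are `C^{1+α}` -/
  holder : ∃ α > (0:ℝ), ∃ H > (0:ℝ), ∀ i,
      (∀ x ∈ Set.Icc (0:ℝ) 1, ∀ y ∈ Set.Icc (0:ℝ) 1, |fx i x - fx i y| ≤ H * |x - y| ^ α) ∧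
      (∀ a ∈ sq, ∀ b ∈ sq, |gx i a - gx i b| ≤ H * dE a b ^ α) ∧
      (∀ a ∈ sq, ∀ b ∈ sq, |gy i a - gy i b| ≤ H * dE a b ^ α)
  /-- the maps `f i`, `g i` (hence `S i`) are uniform contractions -/
  contracting : ∃ c, 0 ≤ c ∧ c < 1 ∧ ∀ i,
      (∀ x ∈ Set.Icc (0:ℝ) 1, ∀ y ∈ Set.Icc (0:ℝ) 1, |f i x - f i y| ≤ c * |x - y|) ∧
      (∀ a ∈ sq, ∀ b ∈ sq, |g i a - g i b| ≤ c * dE a b) ∧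
      (∀ a ∈ sq, ∀ b ∈ sq, dE (f i a.1, g i a) (f i b.1, g i b) ≤ c * dE a b)
  /-- the domination condition:
  `inf |f_{i,x}| > sup |g_{i,y}| ≥ inf |g_{i,y}| ≥ d > 0` -/
  domination : ∃ d > (0:ℝ), ∀ i,
      d ≤ sInf ((fun a => |gy i a|) '' sq) ∧
      sSup ((fun a => |gy i a|) '' sq) < sInf ((fun x => |fx i x|) '' Set.Icc (0:ℝ) 1)

variable {I : Type} [Fintype I]

/-- The map `S i`. -/
def S (T : System I) (i : I) (a : ℝ × ℝ) : ℝ × ℝ := (T.f i a.1, T.g i a)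

/-- The composition `S_w = S_{i₁} ∘ ⋯ ∘ S_{i_n}` along a finite word `w = (i₁,…,i_n)`. -/
def Sw (T : System I) : List I → ℝ × ℝ → ℝ × ℝ
  | [], a => a
  | i :: w, a => S T i (Sw T w a)

/-- The top-left entry `f_{w,x}(a)` of the (lower triangular) Jacobian `D_a S_w`,
via the chain rule. -/
def fxw (T : System I) : List I → ℝ × ℝ → ℝ
  | [], _ => 1
  | i :: w, a => T.fx i (Sw T w a).1 * fxw T w a

/-- The bottom-right entry `g_{w,y}(a)` of the Jacobian `D_a S_w`. -/
def gyw (T : System I) : List I → ℝ × ℝ → ℝ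
  | [], _ => 1
  | i :: w, a => T.gy i (Sw T w a) * gyw T w a

/-- The off-diagonal entry `g_{w,x}(a)` of the Jacobian `D_a S_w`. -/
def gxw (T : System I) : List I → ℝ × ℝ → ℝ
  | [], _ => 0
  | i :: w, a => T.gx i (Sw T w a) * fxw T w a + T.gy i (Sw T w a) * gxw T w a

/-- The Jacobian matrix `D_a S_w`. -/
def Dmat (T : System I) (w : List I) (a : ℝ × ℝ) : Matrix (Fin 2) (Fin 2) ℝ :=
  !![fxw T w a, 0; gxw T w a, gyw T w a]

/-- The larger singular value `α₁(D_a S_w)`. -/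
def alpha1 (T : System I) (w : List I) (a : ℝ × ℝ) : ℝ := sv1 (Dmat T w a)

/-- The smaller singular value `α₂(D_a S_w)`. -/
def alpha2 (T : System I) (w : List I) (a : ℝ × ℝ) : ℝ := sv2 (Dmat T w a)

/-- The restriction `i|n` of an infinite sequence to its first `n` symbols. -/
def word (ii : ℕ → I) (n : ℕ) : List I := List.ofFn (fun k : Fin n => ii k.1)

/-- The iterated left shift `σⁿ`. -/
def shiftn (ii : ℕ → I) (n : ℕ) : ℕ → I := fun k => ii (k + n)

/-- The left shift `σ` on `Σ = I^ℕ`. -/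
def shift (ii : ℕ → I) : ℕ → I := fun k => ii (k + 1)

/-- The cylinder set `[w] ⊆ Σ` of a finite word `w`. -/
def cyl (w : List I) : Set (ℕ → I) := {jj | ∀ k : Fin w.length, jj k.1 = w.get k}

/-- `F` is the attractor of the IFS: the (unique) nonempty compact subset of the unit
square with `F = ⋃ i, S i '' F`. -/
def IsAttractor (T : System I) (F : Set (ℝ × ℝ)) : Prop :=
  F.Nonempty ∧ IsCompact F ∧ F ⊆ sq ∧ F = ⋃ i, S T i '' F

/-- The strong separation condition: the sets `S i '' F` are pairwise disjoint. -/
def SSC (T : System I) (F : Set (ℝ × ℝ)) : Prop :=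
  ∀ i j : I, i ≠ j → Disjoint (S T i '' F) (S T j '' F)

/-- `Pi` is the canonical coding map `Π : Σ → [0,1]²`:
`Π(i)` is the unique point of `⋂ₙ S_{i|n}([0,1]²)`. -/
def IsCoding (T : System I) (Pi : (ℕ → I) → ℝ × ℝ) : Prop :=
  ∀ ii : ℕ → I, ∀ n : ℕ, Pi ii ∈ Sw T (word ii n) '' sq

/-- `m` is quasi-Bernoulli with constant `L`:
`L⁻¹ m[w] m[v] ≤ m[wv] ≤ L m[w] m[v]` for all finite words `w, v`. -/
def QuasiBernoulli [MeasurableSpace I] (m : Measure (ℕ → I)) (L : ℝ) : Prop :=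
  0 < L ∧ ∀ w v : List I,
    L⁻¹ * (m (cyl w)).toReal * (m (cyl v)).toReal ≤ (m (cyl (w ++ v))).toReal ∧
    (m (cyl (w ++ v))).toReal ≤ L * (m (cyl w)).toReal * (m (cyl v)).toReal

/-- The interval `Q₁(x,r) = [x - r/2, x + r/2]`. -/
def Q1 (x r : ℝ) : Set ℝ := Set.Icc (x - r / 2) (x + r / 2)

/-- The square `Q₂(a,r) = (a₁ - r/2, a₁ + r/2) × (a₂ - r/2, a₂ + r/2)`. -/
def Q2 (a : ℝ × ℝ) (r : ℝ) : Set (ℝ × ℝ) :=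
  Set.Ioo (a.1 - r / 2) (a.1 + r / 2) ×ˢ Set.Ioo (a.2 - r / 2) (a.2 + r / 2)

/-- The approximate square `B_n(a,r)`: points `b ∈ S_w([0,1]²)` with `|b₁ - a₁| ≤ r/2`. -/
def Bn (T : System I) (w : List I) (a : ℝ × ℝ) (r : ℝ) : Set (ℝ × ℝ) :=
  {b ∈ Sw T w '' sq | |b.1 - a.1| ≤ r / 2}

/-- The closed Euclidean ball in `ℝ²`. -/
def ballE (x : ℝ × ℝ) (r : ℝ) : Set (ℝ × ℝ) := {y | dE x y ≤ r}

/-- A measure on `ℝ` is exact dimensional with dimension `s` if for a.e. `x`,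
`log ν(B(x,r)) / log r → s` as `r → 0⁺`. -/
def ExactDim1 (ν : Measure ℝ) (s : ℝ) : Prop :=
  ∀ᵐ x ∂ν, Tendsto (fun r => Real.log (ν (Metric.closedBall x r)).toReal / Real.log r)
    (nhdsWithin 0 (Set.Ioi 0)) (nhds s)

/-- A measure on `ℝ²` is exact dimensional with dimension `s` (w.r.t. Euclidean balls). -/
def ExactDim2 (ν : Measure (ℝ × ℝ)) (s : ℝ) : Prop :=
  ∀ᵐ x ∂ν, Tendsto (fun r => Real.log (ν (ballE x r)).toReal / Real.log r)
    (nhdsWithin 0 (Set.Ioi 0)) (nhds s)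

/-- `η = sup_{i ∈ I, a, b ∈ [0,1]²} |g_{i,y}(a)| / |f_{i,x}(b)|`. -/
def eta (T : System I) : ℝ :=
  sSup {x : ℝ | ∃ i : I, ∃ a ∈ sq, ∃ b ∈ sq, x = |T.gy i a| / |T.fx i b.1|}

end FFL

open FFL

namespace FFL

section Symbolic

variable {I : Type}

lemma word_length (ii : ℕ → I) (n : ℕ) : (word ii n).length = n := by simp [word]

lemma word_succ (ii : ℕ → I) (n : ℕ) : word ii (n + 1) = ii 0 :: word (shift ii) n := by
  simp [word, shift, List.ofFn_succ]

lemma word_congr {ii jj : ℕ → I} {n : ℕ} (h : ∀ k < n, ii k = jj k) : word ii n = word jj n := by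
  unfold word
  congr 1
  funext k
  exact h k k.2

lemma mem_cyl_ofFn {n : ℕ} (v : Fin n → I) (jj : ℕ → I) :
    jj ∈ cyl (List.ofFn v) ↔ ∀ k : Fin n, jj k = v k := by
  simp only [cyl, mem_ofPred_eq, List.get_ofFn]
  constructor
  · intro h k
    simpa using h (k.cast (by simp))
  · intro h k
    simpa using h (k.cast (by simp))

lemma shiftn_succ (ii : ℕ → I) (n : ℕ) : shiftn ii (n + 1) = shiftn (shift ii) n := by
  funext k
  simp only [shiftn, shift]
  congr 1

lemma cyl_append (w v : List I) :
    cyl (w ++ v) = (fun jj => shiftn jj w.length) ⁻¹' cyl v ∩ cyl w := by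
  ext jj
  simp only [cyl, mem_inter_iff, mem_preimage, mem_ofPred_eq, shiftn, List.get_eq_getElem,
    Fin.forall_iff]
  constructor
  · intro h
    refine ⟨fun k hk => ?_, fun k hk => ?_⟩
    · rw [h (k + w.length) (by simp; omega), List.getElem_append_right (by omega)]
      simp
    · rw [h k (by simp; omega), List.getElem_append_left hk]
  · rintro ⟨h1, h2⟩ k hk
    by_cases hkw : k < w.length
    · rw [h2 k hkw, List.getElem_append_left hkw]
    · have hlen : k - w.length < v.length := by simp at hk; omega
      have := h1 (k - w.length) hlen
      rw [Nat.sub_add_cancel (by omega)] at this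
      rw [this, List.getElem_append_right (by omega)]

lemma measurable_shiftn [MeasurableSpace I] (n : ℕ) : Measurable fun jj : ℕ → I => shiftn jj n :=
  measurable_pi_lambda _ fun k => measurable_pi_apply (k + n)

lemma measurableSet_cyl [MeasurableSpace I] [MeasurableSingletonClass I] (w : List I) : MeasurableSet (cyl w : Set (ℕ → I)) := by
  simp only [cyl, ofPred_forall]
  exact MeasurableSet.iInter fun k => measurable_pi_apply _ (measurableSet_singleton _)

end Symbolic

section Geometry

variable {I : Type} [Fintype I] (T : System I)

lemma dist_le_dE (a b : ℝ × ℝ) : dist a b ≤ dE a b := by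
  rw [Prod.dist_eq, Real.dist_eq, Real.dist_eq]
  refine max_le (Real.abs_le_sqrt ?_) (Real.abs_le_sqrt ?_) <;>
    nlinarith [sq_nonneg (a.1 - b.1), sq_nonneg (a.2 - b.2)]

lemma dE_le_two {a b : ℝ × ℝ} (ha : a ∈ sq) (hb : b ∈ sq) : dE a b ≤ 2 := by
  obtain ⟨⟨h1, h2⟩, h3, h4⟩ := ha
  obtain ⟨⟨h5, h6⟩, h7, h8⟩ := hb
  refine Real.sqrt_le_iff.2 ⟨by norm_num, ?_⟩
  have e1 : |a.1 - b.1| ≤ 1 := abs_le.2 ⟨by linarith, by linarith⟩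
  have e2 : |a.2 - b.2| ≤ 1 := abs_le.2 ⟨by linarith, by linarith⟩
  have := (sq_le_one_iff_abs_le_one _).2 e1
  have := (sq_le_one_iff_abs_le_one _).2 e2
  linarith

lemma Sw_mem (w : List I) {a : ℝ × ℝ} (ha : a ∈ sq) : Sw T w a ∈ sq := by
  induction w with
  | nil => exact ha
  | cons i w ih => exact T.mapsTo i ih

lemma exists_dist_Sw_le : ∃ c : ℝ, 0 ≤ c ∧ c < 1 ∧ ∀ (w : List I), ∀ a ∈ sq, ∀ b ∈ sq,
    dist (Sw T w a) (Sw T w b) ≤ c ^ w.length * 2 := by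
  obtain ⟨c, hc0, hc1, hc⟩ := T.contracting
  refine ⟨c, hc0, hc1, fun w a ha b hb => (dist_le_dE _ _).trans ?_⟩
  induction w with
  | nil => simpa [Sw] using dE_le_two ha hb
  | cons i w ih =>
    calc dE (Sw T (i :: w) a) (Sw T (i :: w) b)
        ≤ c * dE (Sw T w a) (Sw T w b) := (hc i).2.2 _ (Sw_mem T w ha) _ (Sw_mem T w hb)
      _ ≤ c * (c ^ w.length * 2) := by gcongr
      _ = c ^ (i :: w).length * 2 := by rw [List.length_cons]; ring

lemma Sw_fst (w : List I) (a : ℝ × ℝ) : (Sw T w a).1 = (Sw T w (a.1, 0)).1 := by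
  induction w with
  | nil => rfl
  | cons i w ih => simp only [Sw, S, ih]

lemma zero_section_mem {x : ℝ} (hx : x ∈ Icc (0 : ℝ) 1) : (x, (0 : ℝ)) ∈ sq :=
  ⟨hx, by simp⟩

lemma hasDerivWithinAt_Sw_fst (w : List I) {x : ℝ} (hx : x ∈ Icc (0 : ℝ) 1) :
    HasDerivWithinAt (fun t => (Sw T w (t, 0)).1) (fxw T w (x, 0)) (Icc 0 1) x := by
  induction w with
  | nil => exact hasDerivWithinAt_id _ _
  | cons i w ih =>
    exact (T.hasDeriv_f i _ (Sw_mem T w (zero_section_mem hx)).1).comp x ih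
      fun t ht => (Sw_mem T w (zero_section_mem ht)).1

lemma abs_Sw_fst_sub_le (w : List I) {C : ℝ} (hC : ∀ a ∈ sq, |fxw T w a| ≤ C)
    {a b : ℝ × ℝ} (ha : a ∈ sq) (hb : b ∈ sq) :
    |(Sw T w b).1 - (Sw T w a).1| ≤ C * |b.1 - a.1| := by
  rw [Sw_fst T w a, Sw_fst T w b]
  exact (convex_Icc (0 : ℝ) 1).norm_image_sub_le_of_norm_hasDerivWithin_le
    (fun x hx => hasDerivWithinAt_Sw_fst T w hx)
    (fun x hx => hC _ (zero_section_mem hx)) ha.1 hb.1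

variable {T} {Pi : (ℕ → I) → ℝ × ℝ}

lemma IsCoding.mem_sq (hPi : IsCoding T Pi) (jj : ℕ → I) : Pi jj ∈ sq := by
  obtain ⟨a, ha, h⟩ := hPi jj 0
  exact h ▸ Sw_mem T _ ha

lemma IsCoding.tendsto_of_mem (hPi : IsCoding T Pi) (jj : ℕ → I) {x : ℕ → ℝ × ℝ}
    (hx : ∀ n, x n ∈ Sw T (word jj n) '' sq) : Tendsto x atTop (nhds (Pi jj)) := by
  obtain ⟨c, hc0, hc1, hc⟩ := exists_dist_Sw_le T
  rw [tendsto_iff_dist_tendsto_zero]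
  have hlim : Tendsto (fun n : ℕ => c ^ n * 2) atTop (nhds 0) := by
    simpa using (tendsto_pow_atTop_nhds_zero_of_lt_one hc0 hc1).mul_const 2
  refine squeeze_zero (fun _ => dist_nonneg) (fun n => ?_) hlim
  obtain ⟨a, ha, h⟩ := hx n
  obtain ⟨b, hb, h'⟩ := hPi jj n
  rw [← h, ← h']
  simpa only [word_length] using hc (word jj n) a ha b hb

lemma IsCoding.eq_of_mem (hPi : IsCoding T Pi) (jj : ℕ → I) {x : ℝ × ℝ}
    (hx : ∀ n, x ∈ Sw T (word jj n) '' sq) : x = Pi jj :=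
  tendsto_nhds_unique tendsto_const_nhds (hPi.tendsto_of_mem jj hx)

lemma IsCoding.S_shift (hPi : IsCoding T Pi) (jj : ℕ → I) :
    S T (jj 0) (Pi (shift jj)) = Pi jj := by
  refine hPi.eq_of_mem jj fun n => ?_
  cases n with
  | zero => exact ⟨_, T.mapsTo _ (hPi.mem_sq _), rfl⟩
  | succ n =>
    obtain ⟨a, ha, h⟩ := hPi (shift jj) n
    exact ⟨a, ha, by rw [word_succ, ← h, Sw]⟩

lemma IsCoding.Sw_shiftn (hPi : IsCoding T Pi) (jj : ℕ → I) (n : ℕ) :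
    Sw T (word jj n) (Pi (shiftn jj n)) = Pi jj := by
  induction n generalizing jj with
  | zero => rfl
  | succ n ih => rw [word_succ, shiftn_succ, Sw, ih, hPi.S_shift]

lemma IsAttractor.Sw_mem {F : Set (ℝ × ℝ)} (hF : IsAttractor T F) (w : List I) {x : ℝ × ℝ}
    (hx : x ∈ F) : Sw T w x ∈ F := by
  induction w with
  | nil => exact hx
  | cons i w ih =>
    rw [hF.2.2.2]
    exact mem_iUnion.2 ⟨i, _, ih, rfl⟩

lemma IsCoding.mem_attractor (hPi : IsCoding T Pi) {F : Set (ℝ × ℝ)} (hF : IsAttractor T F)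
    (jj : ℕ → I) : Pi jj ∈ F := by
  obtain ⟨x, hx⟩ := hF.1
  exact hF.2.1.isClosed.mem_of_tendsto
    (hPi.tendsto_of_mem jj fun n => ⟨x, hF.2.2.1 hx, rfl⟩)
    (Eventually.of_forall fun n => hF.Sw_mem (word jj n) hx)

lemma continuousOn_S (i : I) : ContinuousOn (S T i) sq := by
  refine ContinuousOn.prodMk ?_ fun a ha => (T.hasDeriv_g i a ha).continuousWithinAt
  have hf : ContinuousOn (T.f i) (Icc 0 1) :=
    fun x hx => (T.hasDeriv_f i x hx).continuousWithinAt
  exact hf.comp continuousOn_fst fun a ha => ha.1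

/-- Under strong separation, measurability of the coding map makes singletons of the
alphabet measurable. -/
lemma IsCoding.measurableSingletonClass [MeasurableSpace I] (hPi : IsCoding T Pi)
    (hPim : Measurable Pi) {F : Set (ℝ × ℝ)} (hF : IsAttractor T F) (hSSC : SSC T F) :
    MeasurableSingletonClass I := by
  refine ⟨fun i => ?_⟩
  have hmem (jj : ℕ → I) : Pi jj ∈ S T (jj 0) '' F :=
    ⟨_, hPi.mem_attractor hF _, hPi.S_shift jj⟩
  have hmeas : MeasurableSet (S T i '' F) :=
    (hF.2.1.image_of_continuousOn ((continuousOn_S i).mono hF.2.2.1)).measurableSet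
  have hconst : Measurable fun j : I => fun _ : ℕ => j :=
    measurable_pi_lambda _ fun _ => measurable_id
  convert hconst (hPim hmeas) using 1
  ext j
  refine ⟨fun h => ?_, fun h => ?_⟩
  · obtain rfl : j = i := h
    exact hmem fun _ => j
  · by_contra hne
    exact (hSSC j i hne).le_bot ⟨hmem fun _ => j, h⟩

/-- If every prefix of a sequence is a prefix of a sequence coded into the closed set `K`, then
the sequence itself is coded into `K`. -/
lemma IsCoding.iInter_prefix_eq (hPi : IsCoding T Pi) {K : Set (ℝ × ℝ)} (hK : IsClosed K) :
    ⋂ N : ℕ, {jj : ℕ → I | ∃ kk ∈ Pi ⁻¹' K, ∀ k < N, jj k = kk k} = Pi ⁻¹' K := by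
  refine Subset.antisymm (fun jj hjj => ?_)
    fun jj hjj => mem_iInter.2 fun N => ⟨jj, hjj, fun _ _ => rfl⟩
  choose kk hkk hpre using mem_iInter.1 hjj
  refine hK.mem_of_tendsto (hPi.tendsto_of_mem jj (x := fun n => Pi (kk n)) fun n => ?_)
    (Eventually.of_forall hkk)
  rw [word_congr (hpre n)]
  exact hPi (kk n) n

end Geometry

section Measure

variable {I : Type} [Fintype I] [MeasurableSpace I] [MeasurableSingletonClass I]

/-- An inequality between measures on cylinders passes to sets depending on finitely many
symbols. -/
lemma const_mul_measureReal_prefix_le {ν ν' : Measure (ℕ → I)} [IsFiniteMeasure ν]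
    [IsFiniteMeasure ν'] {C : ℝ} (h : ∀ w : List I, C * ν.real (cyl w) ≤ ν'.real (cyl w))
    (G : Set (ℕ → I)) (N : ℕ) :
    C * ν.real {jj | ∃ kk ∈ G, ∀ k < N, jj k = kk k} ≤
      ν'.real {jj | ∃ kk ∈ G, ∀ k < N, jj k = kk k} := by
  classical
  set V : Finset (Fin N → I) :=
    Finset.univ.filter fun v => ∃ kk ∈ G, ∀ k : Fin N, v k = kk k
  have hV : {jj | ∃ kk ∈ G, ∀ k < N, jj k = kk k} = ⋃ v ∈ V, cyl (List.ofFn v) := by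
    ext jj
    simp only [mem_ofPred_eq, mem_iUnion, mem_cyl_ofFn, V, Finset.mem_filter, Finset.mem_univ,
      true_and, exists_prop]
    constructor
    · rintro ⟨kk, hkk, hp⟩
      exact ⟨fun k => jj k, ⟨kk, hkk, fun k => hp k k.2⟩, fun _ => rfl⟩
    · rintro ⟨v, ⟨kk, hkk, hp⟩, hv⟩
      exact ⟨kk, hkk, fun k hk => (hv ⟨k, hk⟩).trans (hp ⟨k, hk⟩)⟩
  have hd : PairwiseDisjoint (V : Set (Fin N → I)) fun v => cyl (List.ofFn v) := by
    intro v _ v' _ hne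
    refine disjoint_left.2 fun jj hj hj' => hne (funext fun k => ?_)
    exact ((mem_cyl_ofFn v jj).1 hj k).symm.trans ((mem_cyl_ofFn v' jj).1 hj' k)
  rw [hV, measureReal_biUnion_finset hd fun v _ => measurableSet_cyl _,
    measureReal_biUnion_finset hd fun v _ => measurableSet_cyl _, Finset.mul_sum]
  exact Finset.sum_le_sum fun v _ => h _

lemma measurableSet_agreeing_prefix_mem (G : Set (ℕ → I)) (N : ℕ) :
    MeasurableSet {jj : ℕ → I | ∃ kk ∈ G, ∀ k < N, jj k = kk k} := by
  have hm : Measurable fun (jj : ℕ → I) (k : Fin N) => jj k :=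
    measurable_pi_lambda _ fun k => measurable_pi_apply _
  convert hm (MeasurableSet.of_discrete (s := {v | ∃ kk ∈ G, ∀ k : Fin N, v k = kk k})) using 1
  ext jj
  simp [Fin.forall_iff]

/-- An inequality between measures on cylinders passes to limits of such sets. -/
lemma const_mul_measureReal_iInter_prefix_le {ν ν' : Measure (ℕ → I)} [IsFiniteMeasure ν]
    [IsFiniteMeasure ν'] {C : ℝ} (h : ∀ w : List I, C * ν.real (cyl w) ≤ ν'.real (cyl w))
    (G : Set (ℕ → I)) :
    C * ν.real (⋂ N : ℕ, {jj | ∃ kk ∈ G, ∀ k < N, jj k = kk k}) ≤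
      ν'.real (⋂ N : ℕ, {jj | ∃ kk ∈ G, ∀ k < N, jj k = kk k}) := by
  have hanti : Antitone fun N : ℕ => {jj : ℕ → I | ∃ kk ∈ G, ∀ k < N, jj k = kk k} :=
    fun N N' hN jj ⟨kk, hkk, hp⟩ => ⟨kk, hkk, fun k hk => hp k (hk.trans_le hN)⟩
  have key (ρ : Measure (ℕ → I)) [IsFiniteMeasure ρ] :
      Tendsto (fun N : ℕ => ρ.real {jj | ∃ kk ∈ G, ∀ k < N, jj k = kk k}) atTop
        (nhds (ρ.real (⋂ N : ℕ, {jj | ∃ kk ∈ G, ∀ k < N, jj k = kk k}))) :=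
    (ENNReal.tendsto_toReal (measure_ne_top ρ _)).comp
      (tendsto_measure_iInter_atTop (fun N => (measurableSet_agreeing_prefix_mem G N).nullMeasurableSet)
        hanti ⟨0, measure_ne_top ρ _⟩)
  exact le_of_tendsto_of_tendsto' ((key ν).const_mul C) (key ν')
    fun N => const_mul_measureReal_prefix_le h G N

/-- The lower quasi-Bernoulli bound for preimages of closed sets under the coding map. -/
lemma QuasiBernoulli.le_measureReal_inter {T : System I} {Pi : (ℕ → I) → ℝ × ℝ}
    (hPi : IsCoding T Pi) (hPim : Measurable Pi) {m : Measure (ℕ → I)} [IsFiniteMeasure m]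
    {L : ℝ} (hQB : QuasiBernoulli m L) {K : Set (ℝ × ℝ)} (hK : IsClosed K) (w : List I) :
    L⁻¹ * m.real (cyl w) * m.real (Pi ⁻¹' K) ≤
      m.real ((fun jj => shiftn jj w.length) ⁻¹' (Pi ⁻¹' K) ∩ cyl w) := by
  have hmap (A : Set (ℕ → I)) (hA : MeasurableSet A) :
      ((m.restrict (cyl w)).map fun jj => shiftn jj w.length).real A =
        m.real ((fun jj => shiftn jj w.length) ⁻¹' A ∩ cyl w) := by
    rw [map_measureReal_apply (measurable_shiftn _) hA,
      measureReal_restrict_apply (measurable_shiftn _ hA)]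
  have h := const_mul_measureReal_iInter_prefix_le (ν := m)
    (ν' := (m.restrict (cyl w)).map fun jj => shiftn jj w.length)
    (C := L⁻¹ * m.real (cyl w)) (fun v => by
      rw [hmap _ (measurableSet_cyl v), ← cyl_append]
      exact (hQB.2 w v).1) (Pi ⁻¹' K)
  rwa [hPi.iInter_prefix_eq hK, hmap _ (hPim hK.measurableSet)] at h

end Measure

/-- Comparison of `α₁` with `f_{w,x}` controls the horizontal distortion of `S_w`. -/
lemma abs_Sw_fst_sub_le_half {I : Type} [Fintype I] (T : System I) (w : List I) {M r : ℝ}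
    (hM : 0 < M) (hr : 0 ≤ r) (h : ∀ a ∈ sq, M⁻¹ ≤ alpha1 T w a / |fxw T w a|)
    {a b : ℝ × ℝ} (ha : a ∈ sq) (hb : b ∈ sq)
    (hab : |b.1 - a.1| ≤ M⁻¹ * r / sSup ((fun b => alpha1 T w b) '' sq) / 2) :
    |(Sw T w b).1 - (Sw T w a).1| ≤ r / 2 := by
  have hα (c : ℝ × ℝ) (hc : c ∈ sq) : |fxw T w c| ≤ M * alpha1 T w c := by
    rcases (abs_nonneg (fxw T w c)).eq_or_lt with h0 | h0
    · have := h c hc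
      rw [← h0, div_zero] at this
      exact absurd this (not_le.2 (inv_pos.2 hM))
    · exact (inv_mul_le_iff₀ hM).1 ((le_div_iff₀ h0).1 (h c hc))
  by_cases hbdd : BddAbove ((fun b => alpha1 T w b) '' sq)
  · set s := sSup ((fun b => alpha1 T w b) '' sq)
    have hle (c : ℝ × ℝ) (hc : c ∈ sq) : alpha1 T w c ≤ s := le_csSup hbdd ⟨c, hc, rfl⟩
    have hs0 : 0 ≤ s := (Real.sqrt_nonneg _).trans (hle a ha)
    have hC (c : ℝ × ℝ) (hc : c ∈ sq) : |fxw T w c| ≤ M * s :=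
      (hα c hc).trans (mul_le_mul_of_nonneg_left (hle c hc) hM.le)
    refine (abs_Sw_fst_sub_le T w hC ha hb).trans ?_
    calc M * s * |b.1 - a.1| ≤ M * s * (M⁻¹ * r / s / 2) := by gcongr
      _ = (M * M⁻¹) * (s / s) * (r / 2) := by ring
      _ ≤ 1 * 1 * (r / 2) := by
          rw [mul_inv_cancel₀ hM.ne']
          gcongr
          exact div_self_le_one s
      _ = r / 2 := by ring
  · rw [Real.sSup_of_not_bddAbove hbdd, div_zero, zero_div] at hab
    have : b.1 = a.1 := sub_eq_zero.1 (abs_eq_zero.1 (hab.antisymm (abs_nonneg _)))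
    rw [Sw_fst T w b, Sw_fst T w a, this, sub_self, abs_zero]
    positivity

end FFL

/-- lower bound on the measure of an approximate square. -/
theorem stmt7 {I : Type} [Fintype I] [MeasurableSpace I] (T : System I)
    (F : Set (ℝ × ℝ)) (hF : IsAttractor T F) (hSSC : SSC T F)
    (Pi : (ℕ → I) → ℝ × ℝ) (hPi : IsCoding T Pi) (hPim : Measurable Pi)
    (m : Measure (ℕ → I)) [IsProbabilityMeasure m]
    (hshift : MeasurePreserving (shift : (ℕ → I) → ℕ → I) m m)
    (L : ℝ) (hQB : QuasiBernoulli m L)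
    (M : ℝ) (hM1 : 1 ≤ M)
    (hM : ∀ a ∈ sq, ∀ (jj : ℕ → I) (n : ℕ),
      M⁻¹ ≤ alpha1 T (word jj n) a / |fxw T (word jj n) a| ∧
      alpha1 T (word jj n) a / |fxw T (word jj n) a| ≤ M)
    (r : ℝ) (hr : 0 < r) (n : ℕ) (ii : ℕ → I) (a : ℝ × ℝ)
    (haF : a ∈ F) (haPi : Pi ii = a) :
    L⁻¹ * (m (cyl (word ii n))).toReal *
        (((m.map Pi).map Prod.fst)
          (Q1 (Pi (shiftn ii n)).1
            (M⁻¹ * r / sSup ((fun b => alpha1 T (word ii n) b) '' sq)))).toReal ≤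
      ((m.map Pi) (Bn T (word ii n) a r)).toReal := by
  have := hPi.measurableSingletonClass hPim hF hSSC
  have hK : IsClosed (Prod.fst ⁻¹' Q1 (Pi (shiftn ii n)).1
      (M⁻¹ * r / sSup ((fun b => alpha1 T (word ii n) b) '' sq)) : Set (ℝ × ℝ)) :=
    isClosed_Icc.preimage continuous_fst
  rw [Measure.map_apply measurable_fst (by exact measurableSet_Icc),
    Measure.map_apply hPim hK.measurableSet]
  refine (hQB.le_measureReal_inter hPi hPim hK (word ii n)).trans ?_
  have : IsProbabilityMeasure (m.map Pi) := Measure.isProbabilityMeasure_map hPim.aemeasurable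
  refine ENNReal.toReal_mono (measure_ne_top _ _)
    ((measure_mono ?_).trans (Measure.le_map_apply hPim.aemeasurable _))
  rintro jj ⟨hjK, hjc⟩
  have hword : word jj n = word ii n := word_congr fun k hk =>
    (mem_cyl_ofFn (fun k : Fin n => ii k) jj).1 hjc ⟨k, hk⟩
  refine ⟨hword ▸ hPi jj n, ?_⟩
  rw [word_length] at hjK
  rw [← haPi, ← hPi.Sw_shiftn jj n, ← hPi.Sw_shiftn ii n, hword]
  refine abs_Sw_fst_sub_le_half T _ (zero_lt_one.trans_le hM1) hr.le
    (fun c hc => (hM c hc ii n).1) (hPi.mem_sq _) (hPi.mem_sq _) ?_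
  have h : (Pi (shiftn jj n)).1 ∈ Icc _ _ := hjK
  exact abs_le.2 ⟨by linarith [h.1], by linarith [h.2]⟩
end
end

section
/- There exists a constant c > 0 such that for every finite word i over I and all points a = (a₁,a₂), b = (b₁,b₂) ∈ [0,1]², setting c' = (b₁, a₂), one has d(S_i(a), S_i(b)) ≥ c · (d(S_i(a), S_i(c')) + d(S_i(c'), S_i(b))), where d denotes the Euclidean metric on ℝ². -/
open MeasureTheory Filter Set

noncomputable section

open FFL

namespace FFL

variable {I : Type} [Fintype I]

theorem Sw_mem_sq (T : System I) (w : List I) {a : ℝ × ℝ} (ha : a ∈ sq) : Sw T w a ∈ sq := by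
  induction w with
  | nil => exact ha
  | cons i w ih => exact T.mapsTo i ih

/-- The first coordinate of `S_w a` depends only on the first coordinate of `a`. -/
theorem Sw_fst_congr (T : System I) (w : List I) {a b : ℝ × ℝ} (h : a.1 = b.1) :
    (Sw T w a).1 = (Sw T w b).1 := by
  induction w with
  | nil => exact h
  | cons i w ih => exact congrArg (T.f i) ih

/-- A lower bound for the derivative on `[0,1]` yields a lower bound for difference quotients. -/
theorem mul_abs_sub_le_of_le_abs_deriv {h h' : ℝ → ℝ} {m : ℝ}
    (hd : ∀ x ∈ Set.Icc (0:ℝ) 1, HasDerivWithinAt h (h' x) (Set.Icc (0:ℝ) 1) x)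
    (hm : ∀ x ∈ Set.Icc (0:ℝ) 1, m ≤ |h' x|) {x y : ℝ}
    (hx : x ∈ Set.Icc (0:ℝ) 1) (hy : y ∈ Set.Icc (0:ℝ) 1) :
    m * |x - y| ≤ |h x - h y| := by
  wlog hxy : x ≤ y generalizing x y
  · rw [abs_sub_comm x, abs_sub_comm (h x)]
    exact this hy hx (le_of_not_ge hxy)
  rcases hxy.eq_or_lt with rfl | hlt
  · simp
  have hsub : Set.Icc x y ⊆ Set.Icc (0:ℝ) 1 := Set.Icc_subset_Icc hx.1 hy.2
  obtain ⟨z, hz, hslope⟩ := exists_hasDerivAt_eq_slope h h' hlt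
    (fun z hz => ((hd z (hsub hz)).continuousWithinAt).mono hsub)
    (fun z hz => (hd z (hsub (Set.Ioo_subset_Icc_self hz))).hasDerivAt
      (Icc_mem_nhds (hx.1.trans_lt hz.1) (hz.2.trans_le hy.2)))
  have hyx : 0 < y - x := sub_pos.2 hlt
  rw [eq_div_iff hyx.ne'] at hslope
  rw [abs_sub_comm x, abs_sub_comm (h x), ← hslope, abs_mul]
  exact mul_le_mul_of_nonneg_right (hm z (hsub (Set.Ioo_subset_Icc_self hz))) (abs_nonneg _)

theorem abs_fst_le_dE (a b : ℝ × ℝ) : |a.1 - b.1| ≤ dE a b :=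
  Real.abs_le_sqrt (le_add_of_nonneg_right (sq_nonneg _))

theorem abs_snd_le_dE (a b : ℝ × ℝ) : |a.2 - b.2| ≤ dE a b :=
  Real.abs_le_sqrt (le_add_of_nonneg_left (sq_nonneg _))

theorem dE_le_add (a b : ℝ × ℝ) : dE a b ≤ |a.1 - b.1| + |a.2 - b.2| := by
  refine Real.sqrt_le_iff.2 ⟨by positivity, ?_⟩
  have := mul_nonneg (abs_nonneg (a.1 - b.1)) (abs_nonneg (a.2 - b.2))
  rw [← sq_abs (a.1 - b.1), ← sq_abs (a.2 - b.2)]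
  linarith [add_sq |a.1 - b.1| |a.2 - b.2|]

theorem bddAbove_abs_gy (T : System I) (i : I) :
    BddAbove ((fun a => |T.gy i a|) '' sq) := by
  obtain ⟨α, hα, H, hH, hol⟩ := T.holder
  have h0 : ((0, 0) : ℝ × ℝ) ∈ sq := by simp [sq]
  refine ⟨|T.gy i (0, 0)| + H * 2 ^ α, ?_⟩
  rintro _ ⟨a, ha, rfl⟩
  have hdist : dE a (0, 0) ≤ 2 := by
    obtain ⟨⟨h1, h2⟩, h3, h4⟩ := ha
    have := dE_le_add a (0, 0)
    simp only [sub_zero, abs_of_nonneg h1, abs_of_nonneg h3] at this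
    linarith
  have hpow : dE a (0, 0) ^ α ≤ 2 ^ α := Real.rpow_le_rpow (Real.sqrt_nonneg _) hdist hα.le
  have h1 := (hol i).2.2 a ha _ h0
  have h2 := mul_le_mul_of_nonneg_left hpow hH.le
  have h3 := abs_sub_abs_le_abs_sub (T.gy i a) (T.gy i (0, 0))
  show |T.gy i a| ≤ _
  linarith

/-- An upper bound for `|g_{i,y}|` is a Lipschitz constant for `g_i` on vertical segments. -/
theorem abs_g_sub_le_of_vertical (T : System I) (i : I) {s : ℝ}
    (hs : ∀ a ∈ sq, |T.gy i a| ≤ s) {x y z : ℝ} (hx : x ∈ Set.Icc (0:ℝ) 1)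
    (hy : y ∈ Set.Icc (0:ℝ) 1) (hz : z ∈ Set.Icc (0:ℝ) 1) :
    |T.g i (x, y) - T.g i (x, z)| ≤ s * |y - z| := by
  have hd : ∀ t ∈ Set.Icc (0:ℝ) 1, HasDerivWithinAt (fun t => T.g i (x, t)) (T.gy i (x, t))
      (Set.Icc (0:ℝ) 1) t := by
    intro t ht
    have hline : HasDerivWithinAt (fun t : ℝ => (x, t)) (0, 1) (Set.Icc (0:ℝ) 1) t :=
      (hasDerivWithinAt_const t _ x).prodMk (hasDerivWithinAt_id t _)
    have hcomp := (T.hasDeriv_g i (x, t) ⟨hx, ht⟩).comp_hasDerivWithinAt t hline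
      (fun u hu => ⟨hx, hu⟩)
    refine hcomp.congr_deriv ?_
    simp
  exact (convex_Icc (0:ℝ) 1).norm_image_sub_le_of_norm_hasDerivWithin_le hd
    (fun t ht => hs (x, t) ⟨hx, ht⟩) hz hy

/-- Contractivity bounds `g_i` along horizontal segments, so `g_i` is controlled by both
coordinate differences separately. -/
theorem abs_g_sub_le (T : System I) (i : I) {s : ℝ}
    (hs : ∀ a ∈ sq, |T.gy i a| ≤ s) {p q : ℝ × ℝ} (hp : p ∈ sq) (hq : q ∈ sq) :
    |T.g i p - T.g i q| ≤ |p.1 - q.1| + s * |p.2 - q.2| := by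
  obtain ⟨c, -, hc, hcon⟩ := T.contracting
  have hhor := (hcon i).2.1 p hp (q.1, p.2) ⟨hq.1, hp.2⟩
  have hdist := dE_le_add p (q.1, p.2)
  simp only [sub_self, abs_zero, add_zero] at hdist
  have hver : |T.g i (q.1, p.2) - T.g i q| ≤ s * |p.2 - q.2| :=
    abs_g_sub_le_of_vertical T i hs hq.1 hp.2 hq.2
  have hle : c * dE p (q.1, p.2) ≤ dE p (q.1, p.2) :=
    mul_le_of_le_one_left (Real.sqrt_nonneg _) hc.le
  have htri := abs_sub_le (T.g i p) (T.g i (q.1, p.2)) (T.g i q)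
  linarith

/-- Domination makes the cone of slope at most `K` invariant under every `S i`. -/
theorem exists_slope_bound (T : System I) :
    ∃ K ≥ (0:ℝ), ∀ i, ∀ p ∈ sq, ∀ q ∈ sq, |p.2 - q.2| ≤ K * |p.1 - q.1| →
      |(S T i p).2 - (S T i q).2| ≤ K * |(S T i p).1 - (S T i q).1| := by
  obtain ⟨d, -, hdom⟩ := T.domination
  set s : I → ℝ := fun i => sSup ((fun a => |T.gy i a|) '' sq)
  set m : I → ℝ := fun i => sInf ((fun x => |T.fx i x|) '' Set.Icc (0:ℝ) 1)
  have hgap : ∀ i, 0 < m i - s i := fun i => sub_pos.2 (hdom i).2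
  have hterm : ∀ i ∈ Finset.univ, 0 ≤ (m i - s i)⁻¹ := fun i _ => (inv_pos.2 (hgap i)).le
  refine ⟨∑ i, (m i - s i)⁻¹, Finset.sum_nonneg hterm, fun i p hp q hq hpq => ?_⟩
  set K := ∑ i, (m i - s i)⁻¹
  have hK : 1 ≤ K * (m i - s i) := by
    rw [← inv_le_iff_one_le_mul₀ (hgap i)]
    exact Finset.single_le_sum hterm (Finset.mem_univ i)
  have hs : ∀ a ∈ sq, |T.gy i a| ≤ s i := fun a ha =>
    le_csSup (bddAbove_abs_gy T i) (Set.mem_image_of_mem _ ha)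
  have hm : ∀ x ∈ Set.Icc (0:ℝ) 1, m i ≤ |T.fx i x| := fun x hx =>
    csInf_le ⟨0, by rintro _ ⟨y, -, rfl⟩; exact abs_nonneg _⟩ (Set.mem_image_of_mem _ hx)
  have hf := mul_abs_sub_le_of_le_abs_deriv (T.hasDeriv_f i) hm hp.1 hq.1
  have hs0 : 0 ≤ s i := (abs_nonneg _).trans (hs p hp)
  have hK0 : 0 ≤ K := Finset.sum_nonneg hterm
  show |T.g i p - T.g i q| ≤ K * |T.f i p.1 - T.f i q.1|
  calc |T.g i p - T.g i q| ≤ |p.1 - q.1| + s i * |p.2 - q.2| := abs_g_sub_le T i hs hp hq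
    _ ≤ 1 * |p.1 - q.1| + s i * (K * |p.1 - q.1|) := by gcongr; rw [one_mul]
    _ ≤ K * (m i - s i) * |p.1 - q.1| + s i * (K * |p.1 - q.1|) := by gcongr
    _ = K * (m i * |p.1 - q.1|) := by ring
    _ ≤ K * |T.f i p.1 - T.f i q.1| := by gcongr

end FFL

/-- the triangle inequality via the intermediate point `c' = (b₁, a₂)`
reverses up to a constant. -/
theorem stmt12 {I : Type} [Fintype I] (T : System I) :
    ∃ c > (0:ℝ), ∀ (w : List I), ∀ a ∈ sq, ∀ b ∈ sq,
      c * (dE (Sw T w a) (Sw T w (b.1, a.2)) + dE (Sw T w (b.1, a.2)) (Sw T w b)) ≤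
        dE (Sw T w a) (Sw T w b) := by
  obtain ⟨K, hK, hcone⟩ := exists_slope_bound T
  refine ⟨(2 + 2 * K)⁻¹, by positivity, fun w a ha b hb => ?_⟩
  have hc : (b.1, a.2) ∈ sq := ⟨hb.1, ha.2⟩
  have hslope : |(Sw T w a).2 - (Sw T w (b.1, a.2)).2| ≤
      K * |(Sw T w a).1 - (Sw T w (b.1, a.2)).1| := by
    induction w with
    | nil => simpa [Sw] using mul_nonneg hK (abs_nonneg _)
    | cons i w ih => exact hcone i _ (Sw_mem_sq T w ha) _ (Sw_mem_sq T w hc) ih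
  have hfst : (Sw T w (b.1, a.2)).1 = (Sw T w b).1 := Sw_fst_congr T w rfl
  generalize Sw T w (b.1, a.2) = r at *
  generalize Sw T w a = p at *
  generalize Sw T w b = q at *
  have hpr := dE_le_add p r
  have hrq := dE_le_add r q
  have htri := abs_sub_le r.2 p.2 q.2
  rw [abs_sub_comm r.2 p.2] at htri
  rw [hfst] at hpr hslope
  rw [hfst, sub_self, abs_zero] at hrq
  have hx := abs_fst_le_dE p q
  have hy := abs_snd_le_dE p q
  have hKx := mul_le_mul_of_nonneg_left hx hK
  rw [inv_mul_le_iff₀ (by positivity)]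
  linarith
end
end
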